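/- arXiv:2404.03932 — 3 statements merged into one kernel-verified Lean document; each statement's English description precedes it below -/
import Mathlib

section
/- Let g₁, g₂ be linearly independent vectors in ℝ² (with the standard Euclidean inner product), and let g₁* = g₁ and g₂* = g₂ − (⟨g₂,g₁*⟩/‖g₁*‖²)·g₁* be their Gram–Schmidt orthogonalization. Let t ∈ ℝ², and define the integers z₂ = ⌊⟨t, g₂*⟩/‖g₂*‖²⌉ and z₁ = ⌊⟨t − z₂·g₂, g₁*⟩/‖g₁*‖²⌉, where ⌊·⌉ denotes rounding to the nearest integer. If there exist integers w₁, w₂ such that ‖t − (w₁·g₁ + w₂·g₂)‖ < (1/2)·min(‖g₁*‖, ‖g₂*‖), then z₁ = w₁ and z₂ = w₂; in particular, the output z₁·g₁ + z₂·g₂ of Babai's nearest plane algorithm equals w₁·g₁ + w₂·g₂. -/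
open scoped InnerProductSpace

theorem round_aux (e g : EuclideanSpace ℝ (Fin 2)) (w : ℤ) (x : ℝ)
    (he : ‖e‖ < (1 / 2) * ‖g‖) (hx : x = w * ‖g‖ ^ 2 + ⟪e, g⟫_ℝ) :
    round (x / ‖g‖ ^ 2) = w := by
  have hg : 0 < ‖g‖ := by linarith [norm_nonneg e]
  have hg2 : 0 < ‖g‖ ^ 2 := by positivity
  have h1 : |⟪e, g⟫_ℝ| < (1 / 2) * ‖g‖ ^ 2 := by
    have := abs_real_inner_le_norm e g
    nlinarith
  rw [abs_lt] at h1
  rw [round_eq, Int.floor_eq_iff, hx, add_div, mul_div_assoc, div_self hg2.ne']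
  have h2 : -(1 / 2) < ⟪e, g⟫_ℝ / ‖g‖ ^ 2 := by
    rw [lt_div_iff₀ hg2]; linarith [h1.1]
  have h3 : ⟪e, g⟫_ℝ / ‖g‖ ^ 2 < 1 / 2 := by
    rw [div_lt_iff₀ hg2]; linarith [h1.2]
  constructor <;> linarith

theorem stmt4 (g₁ g₂ t : EuclideanSpace ℝ (Fin 2))
    (hind : LinearIndependent ℝ ![g₁, g₂]) (w₁ w₂ : ℤ) :
    let g₁s := g₁
    let g₂s := g₂ - (⟪g₂, g₁s⟫_ℝ / ‖g₁s‖ ^ 2) • g₁s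
    let z₂ := round (⟪t, g₂s⟫_ℝ / ‖g₂s‖ ^ 2)
    let z₁ := round (⟪t - (z₂ : ℝ) • g₂, g₁s⟫_ℝ / ‖g₁s‖ ^ 2)
    ‖t - ((w₁ : ℝ) • g₁ + (w₂ : ℝ) • g₂)‖ < (1 / 2) * min ‖g₁s‖ ‖g₂s‖ →
      z₁ = w₁ ∧ z₂ = w₂ ∧
        (z₁ : ℝ) • g₁ + (z₂ : ℝ) • g₂ = (w₁ : ℝ) • g₁ + (w₂ : ℝ) • g₂ := by
  intro g₁s g₂s z₂ z₁ h
  have hn1 : ‖t - ((w₁ : ℝ) • g₁ + (w₂ : ℝ) • g₂)‖ < (1 / 2) * ‖g₁‖ := by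
    have : min ‖g₁s‖ ‖g₂s‖ ≤ ‖g₁‖ := min_le_left _ _
    linarith
  have hn2 : ‖t - ((w₁ : ℝ) • g₁ + (w₂ : ℝ) • g₂)‖ < (1 / 2) * ‖g₂s‖ := by
    have : min ‖g₁s‖ ‖g₂s‖ ≤ ‖g₂s‖ := min_le_right _ _
    linarith
  have hg : 0 < ‖g₁‖ := by
    linarith [norm_nonneg (t - ((w₁ : ℝ) • g₁ + (w₂ : ℝ) • g₂))]
  have horth : ⟪g₁, g₂s⟫_ℝ = 0 := by
    simp only [g₂s, g₁s, inner_sub_right, inner_smul_right, real_inner_self_eq_norm_sq]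
    rw [div_mul_cancel₀ _ (by positivity), real_inner_comm, sub_self]
  have hself : ⟪g₂, g₂s⟫_ℝ = ‖g₂s‖ ^ 2 := by
    have h2 : g₂ = g₂s + (⟪g₂, g₁s⟫_ℝ / ‖g₁s‖ ^ 2) • g₁ := by simp [g₂s, g₁s]
    rw [← real_inner_self_eq_norm_sq]
    conv_lhs => rw [h2]
    rw [inner_add_left, inner_smul_left, horth, mul_zero, add_zero]
  have hz2 : z₂ = w₂ := by
    apply round_aux _ _ _ _ hn2
    rw [inner_sub_left, inner_add_left, inner_smul_left, inner_smul_left, horth, hself]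
    simp
  have hz1 : z₁ = w₁ := by
    apply round_aux _ _ _ _ hn1
    rw [hz2]
    simp only [g₁s, inner_sub_left, inner_add_left, inner_smul_left,
      real_inner_self_eq_norm_sq, conj_trivial]
    ring
  exact ⟨hz1, hz2, by rw [hz1, hz2]⟩
end

section
/- Let q ≥ 2, n ≥ 1, and k ≥ 0 be integers with 2k + 1 ≤ q. Let d ∈ (ℤ/qℤ)^n be a vector having at least one coordinate that is a unit in ℤ/qℤ, and let e ∈ ℤ/qℤ be arbitrary. Then the number of vectors a ∈ (ℤ/qℤ)^n such that |valMinAbs(⟨a, d⟩ + e)| ≤ k equals (2k + 1)·q^{n−1}. Consequently, for a drawn uniformly from (ℤ/qℤ)^n, the probability of this event is (2k + 1)/q. -/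
lemma card_base (q k : ℕ) [NeZero q] (hk : 2 * k + 1 ≤ q) :
    Nat.card {z : ZMod q // |z.valMinAbs| ≤ (k : ℤ)} = 2 * k + 1 := by
  have key : ∀ y : ℤ, |y| ≤ (k : ℤ) → ((y : ZMod q)).valMinAbs = y := by
    intro y hy
    rw [ZMod.valMinAbs_spec]
    rw [abs_le] at hy
    refine ⟨rfl, ?_, ?_⟩ <;> omega
  let E : {z : ZMod q // |z.valMinAbs| ≤ (k : ℤ)} ≃ (Finset.Icc (-(k : ℤ)) k) :=
    { toFun := fun z => ⟨z.1.valMinAbs, Finset.mem_Icc.2 (abs_le.1 z.2)⟩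
      invFun := fun y => ⟨(y.1 : ZMod q), by
        have h := abs_le.2 (Finset.mem_Icc.1 y.2)
        rw [key _ h]; exact h⟩
      left_inv := fun z => Subtype.ext (ZMod.coe_valMinAbs z.1)
      right_inv := fun y => Subtype.ext (key _ (abs_le.2 (Finset.mem_Icc.1 y.2))) }
  rw [Nat.card_congr E, Nat.card_eq_fintype_card, Fintype.card_coe, Int.card_Icc]
  omega

lemma card_main (q m k : ℕ) [NeZero q] (hk : 2 * k + 1 ≤ q)
    (d : Fin (m + 1) → ZMod q) (hd : ∃ i, IsUnit (d i)) (e : ZMod q) :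
    Nat.card {a : Fin (m + 1) → ZMod q // |(∑ i, a i * d i + e).valMinAbs| ≤ (k : ℤ)} =
        (2 * k + 1) * q ^ m := by
  obtain ⟨i, u, hu⟩ := hd
  have key : ∀ (z : ZMod q) (b : Fin m → ZMod q),
      ∑ j, (i.insertNth ((z - e - ∑ j, b j * d (i.succAbove j)) * (↑u⁻¹ : ZMod q)) b :
        Fin (m + 1) → ZMod q) j * d j + e = z := by
    intro z b
    rw [Fin.sum_univ_succAbove _ i]
    simp only [Fin.insertNth_apply_same, Fin.insertNth_apply_succAbove, ← hu,
      Units.inv_mul_cancel_right]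
    ring
  let E : {a : Fin (m + 1) → ZMod q // |(∑ i, a i * d i + e).valMinAbs| ≤ (k : ℤ)} ≃
      {z : ZMod q // |z.valMinAbs| ≤ (k : ℤ)} × (Fin m → ZMod q) :=
    { toFun := fun a => (⟨∑ i, a.1 i * d i + e, a.2⟩, fun j => a.1 (i.succAbove j))
      invFun := fun p => ⟨i.insertNth
        ((p.1.1 - e - ∑ j, p.2 j * d (i.succAbove j)) * (↑u⁻¹ : ZMod q)) p.2, by
          rw [key]; exact p.1.2⟩
      left_inv := by
        rintro ⟨a, ha⟩
        apply Subtype.ext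
        funext j
        refine Fin.succAboveCases i ?_ (fun j => ?_) j
        · simp only [Fin.insertNth_apply_same]
          rw [Fin.sum_univ_succAbove _ i, ← hu, Units.mul_inv_eq_iff_eq_mul]
          ring
        · simp only [Fin.insertNth_apply_succAbove]
      right_inv := by
        rintro ⟨⟨z, hz⟩, b⟩
        refine Prod.ext (Subtype.ext (key z b)) ?_
        funext j
        simp only [Fin.insertNth_apply_succAbove] }
  rw [Nat.card_congr E, Nat.card_prod, card_base q k hk]
  simp [Nat.card_eq_fintype_card, ZMod.card]

theorem stmt14 (q n k : ℕ) (hq : 2 ≤ q) [NeZero q] (hn : 1 ≤ n) (hk : 2 * k + 1 ≤ q)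
    (d : Fin n → ZMod q) (hd : ∃ i, IsUnit (d i)) (e : ZMod q) :
    Nat.card {a : Fin n → ZMod q // |(∑ i, a i * d i + e).valMinAbs| ≤ (k : ℤ)} =
        (2 * k + 1) * q ^ (n - 1) ∧
      (Nat.card {a : Fin n → ZMod q // |(∑ i, a i * d i + e).valMinAbs| ≤ (k : ℤ)} : ℚ) /
          (q : ℚ) ^ n = (2 * (k : ℚ) + 1) / q := by
  obtain ⟨m, rfl⟩ : ∃ m, n = m + 1 := ⟨n - 1, by omega⟩
  have h := card_main q m k hk d hd e
  refine ⟨h, ?_⟩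
  rw [h]
  have hq0 : (q : ℚ) ≠ 0 := by exact_mod_cast NeZero.ne q
  push_cast
  rw [pow_succ]
  field_simp
end

section
/- Let q ≥ 2 be an integer, a = (a₁, a₂) ∈ ℤ² with a₁ invertible modulo q, s ∈ ℤ, ξ' ≥ 0, and e = (e₁, e₂) ∈ ℤ² with |e₁|, |e₂| ≤ ξ'. Let b ∈ ℤ² satisfy b ≡ s·a + e (mod q) componentwise, and let L = { v ∈ ℤ² : ∃ x ∈ ℤ, v ≡ x·a (mod q) }. Let g₁, g₂ be any basis of L (as a ℤ-module) whose Gram–Schmidt vectors g₁* = g₁ and g₂* = g₂ − (⟨g₂,g₁*⟩/‖g₁*‖²)·g₁* satisfy min(‖g₁*‖, ‖g₂*‖) > 2√2·ξ'. Then Babai's nearest plane algorithm with inputs g₁, g₂ and target b outputs the vector w = b − e; in particular w ≡ s·a (mod q), so s is recovered as s ≡ a₁^{−1}·w₁ (mod q). -/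
open scoped InnerProductSpace

/-- Embedding of integer pairs into the Euclidean plane. -/
noncomputable def embed (p : ℤ × ℤ) : EuclideanSpace ℝ (Fin 2) :=
  (WithLp.equiv 2 (Fin 2 → ℝ)).symm ![(p.1 : ℝ), (p.2 : ℝ)]

theorem round_aux_s17 {V : Type*} [NormedAddCommGroup V] [InnerProductSpace ℝ V] (E G : V) (m : ℤ)
    (h : 2 * ‖E‖ < ‖G‖) : round ((m : ℝ) + ⟪E, G⟫_ℝ / ‖G‖ ^ 2) = m := by
  have hG : 0 < ‖G‖ := by linarith [norm_nonneg E]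
  have h1 : |⟪E, G⟫_ℝ / ‖G‖ ^ 2| < 1 / 2 := by
    rw [abs_div, abs_of_pos (pow_pos hG 2), div_lt_iff₀ (pow_pos hG 2)]
    have := abs_real_inner_le_norm E G
    nlinarith
  rw [abs_lt] at h1
  rw [round_eq, Int.floor_eq_iff]
  constructor <;> linarith [h1.1, h1.2]

theorem babai_aux {V : Type*} [NormedAddCommGroup V] [InnerProductSpace ℝ V] (E G₁ G₂ G t : V)
    (m₁ m₂ : ℤ) (hG : G = G₂ - (⟪G₂, G₁⟫_ℝ / ‖G₁‖ ^ 2) • G₁)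
    (ht : t = (m₁ : ℝ) • G₁ + (m₂ : ℝ) • G₂ + E)
    (h₁ : 2 * ‖E‖ < ‖G₁‖) (h₂ : 2 * ‖E‖ < ‖G‖) :
    round (⟪t, G⟫_ℝ / ‖G‖ ^ 2) = m₂ ∧
      round (⟪t - (m₂ : ℝ) • G₂, G₁⟫_ℝ / ‖G₁‖ ^ 2) = m₁ := by
  have p₁ : 0 < ‖G₁‖ := by linarith [norm_nonneg E]
  have p₂ : 0 < ‖G‖ := by linarith [norm_nonneg E]
  have o : ⟪G₁, G⟫_ℝ = 0 := by
    rw [hG, inner_sub_right, inner_smul_right, real_inner_self_eq_norm_sq, real_inner_comm]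
    field_simp
    ring
  have o2 : ⟪G₂, G⟫_ℝ = ‖G‖ ^ 2 := by
    have : G₂ = G + (⟪G₂, G₁⟫_ℝ / ‖G₁‖ ^ 2) • G₁ := by rw [hG]; abel
    rw [← real_inner_self_eq_norm_sq]
    conv_lhs => rw [this]
    rw [inner_add_left, inner_smul_left, o]
    simp
  constructor
  · conv_rhs => rw [← round_aux_s17 E G m₂ h₂]
    rw [ht, inner_add_left, inner_add_left, inner_smul_left,
      inner_smul_left, o, o2]
    congr 1
    simp
    field_simp
  · have : t - (m₂ : ℝ) • G₂ = (m₁ : ℝ) • G₁ + E := by rw [ht]; abel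
    rw [this, inner_add_left, inner_smul_left, real_inner_self_eq_norm_sq]
    conv_rhs => rw [← round_aux_s17 E G₁ m₁ h₁]
    congr 1
    simp
    field_simp

theorem stmt17 (q : ℕ) (hq : 2 ≤ q) (a₁ a₂ : ℤ) (hinv : Int.gcd a₁ q = 1)
    (c : ℤ) (hc : (q : ℤ) ∣ a₁ * c - 1)
    (s : ℤ) (ξ : ℝ) (hξ : 0 ≤ ξ) (e₁ e₂ : ℤ)
    (he₁ : (|e₁| : ℝ) ≤ ξ) (he₂ : (|e₂| : ℝ) ≤ ξ)
    (b : ℤ × ℤ) (hb₁ : (q : ℤ) ∣ b.1 - (s * a₁ + e₁)) (hb₂ : (q : ℤ) ∣ b.2 - (s * a₂ + e₂))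
    (g₁ g₂ : ℤ × ℤ)
    (hbasis : ∀ v : ℤ × ℤ,
      (∃ x : ℤ, (q : ℤ) ∣ v.1 - x * a₁ ∧ (q : ℤ) ∣ v.2 - x * a₂) ↔
        ∃ z₁ z₂ : ℤ, v = z₁ • g₁ + z₂ • g₂) :
    let G₁ := embed g₁
    let G₂ := embed g₂
    let G₂s := G₂ - (⟪G₂, G₁⟫_ℝ / ‖G₁‖ ^ 2) • G₁
    let t := embed b
    let z₂ := round (⟪t, G₂s⟫_ℝ / ‖G₂s‖ ^ 2)
    let z₁ := round (⟪t - (z₂ : ℝ) • G₂, G₁⟫_ℝ / ‖G₁‖ ^ 2)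
    2 * Real.sqrt 2 * ξ < min ‖G₁‖ ‖G₂s‖ →
      (z₁ : ℝ) • G₁ + (z₂ : ℝ) • G₂ = embed (b - (e₁, e₂)) ∧
        (q : ℤ) ∣ (b.1 - e₁) - s * a₁ ∧ (q : ℤ) ∣ (b.2 - e₂) - s * a₂ ∧
        (q : ℤ) ∣ s - c * (b.1 - e₁) := by
  intro G₁ G₂ G₂s t z₂ z₁ hmin
  have d₁ : (q : ℤ) ∣ (b.1 - e₁) - s * a₁ := by
    convert hb₁ using 1; ring
  have d₂ : (q : ℤ) ∣ (b.2 - e₂) - s * a₂ := by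
    convert hb₂ using 1; ring
  refine ⟨?_, d₁, d₂, ?_⟩
  · obtain ⟨m₁, m₂, hm⟩ := (hbasis (b - (e₁, e₂))).1 ⟨s, d₁, d₂⟩
    have hw : embed (b - (e₁, e₂)) = (m₁ : ℝ) • G₁ + (m₂ : ℝ) • G₂ := by
      rw [hm]
      ext i
      fin_cases i <;> simp [embed, G₁, G₂]
    have ht : t = (m₁ : ℝ) • G₁ + (m₂ : ℝ) • G₂ + embed (e₁, e₂) := by
      rw [← hw]
      ext i
      fin_cases i <;> simp [embed, t]
    have hE : ‖embed (e₁, e₂)‖ ≤ Real.sqrt 2 * ξ := by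
      have e : Real.sqrt 2 * ξ = Real.sqrt (2 * ξ ^ 2) := by
        rw [Real.sqrt_mul (by norm_num), Real.sqrt_sq hξ]
      rw [e, EuclideanSpace.norm_eq]
      apply Real.sqrt_le_sqrt
      have k₁ := sq_le_sq' (by linarith [neg_abs_le (e₁ : ℝ)]) ((le_abs_self (e₁ : ℝ)).trans he₁)
      have k₂ := sq_le_sq' (by linarith [neg_abs_le (e₂ : ℝ)]) ((le_abs_self (e₂ : ℝ)).trans he₂)
      simp [embed]
      linarith
    obtain ⟨l₁, l₂⟩ := lt_min_iff.1 hmin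
    obtain ⟨r₂, r₁⟩ := babai_aux (embed (e₁, e₂)) G₁ G₂ G₂s t m₁ m₂ rfl ht
      (by linarith) (by linarith)
    have hz₂ : z₂ = m₂ := r₂
    have hz₁ : z₁ = m₁ := by
      rw [← r₁, ← hz₂]
    rw [hz₁, hz₂, hw]
  · have : s - c * (b.1 - e₁) = -(c * ((b.1 - e₁) - s * a₁)) - s * (a₁ * c - 1) := by ring
    rw [this]
    exact dvd_sub ((d₁.mul_left c).neg_right) (hc.mul_left s)
end
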